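/- For every integer d ≥ 4, every 2-neighborly d-polytope with exactly d+2 vertices has at least d+5 facets. -/

import Mathlib

open Set

/-- A polytope is the convex hull of a finite set of points. -/
def IsPolytope {N : ℕ} (P : Set (Fin N → ℝ)) : Prop :=
  ∃ S : Finset (Fin N → ℝ), P = convexHull ℝ (S : Set (Fin N → ℝ))

/-- The dimension of a set: the dimension of its affine span. -/
noncomputable def pdim {N : ℕ} (P : Set (Fin N → ℝ)) : ℕ :=
  Module.finrank ℝ (affineSpan ℝ P).direction

/-- A vertex is a 0-dimensional (exposed) face, i.e. an exposed singleton. -/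
def IsVertex {N : ℕ} (P : Set (Fin N → ℝ)) (v : Fin N → ℝ) : Prop :=
  IsExposed ℝ P {v}

/-- The set of vertices of `P`. -/
def vertexSet {N : ℕ} (P : Set (Fin N → ℝ)) : Set (Fin N → ℝ) :=
  {v | IsVertex P v}

/-- A facet is a nonempty exposed face of dimension one less than the polytope. -/
def IsFacetOf {N : ℕ} (P F : Set (Fin N → ℝ)) : Prop :=
  IsExposed ℝ P F ∧ F.Nonempty ∧ pdim F + 1 = pdim P

/-- The set of facets of `P`. -/
def facetSet {N : ℕ} (P : Set (Fin N → ℝ)) : Set (Set (Fin N → ℝ)) :=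
  {F | IsFacetOf P F}

/-- A polytope is 2-neighborly if every pair of distinct vertices is the vertex set of
an edge (1-dimensional face), i.e. the segment between them is an exposed face. -/
def TwoNeighborly {N : ℕ} (P : Set (Fin N → ℝ)) : Prop :=
  ∀ u v : Fin N → ℝ, IsVertex P u → IsVertex P v → u ≠ v →
    IsExposed ℝ P (convexHull ℝ {u, v}) ∧ pdim (convexHull ℝ ({u, v} : Set (Fin N → ℝ))) = 1

/-- A polytope is 2-simplicial if every 2-dimensional face has exactly 3 vertices. -/
def TwoSimplicial {N : ℕ} (P : Set (Fin N → ℝ)) : Prop :=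
  ∀ F : Set (Fin N → ℝ), IsExposed ℝ P F → F.Nonempty → pdim F = 2 →
    (vertexSet F).ncard = 3

/-- A polytope is a pyramid if some vertex (the apex) is not in the affine span
of the remaining vertices. -/
def IsPyramid {N : ℕ} (P : Set (Fin N → ℝ)) : Prop :=
  ∃ v : Fin N → ℝ, IsVertex P v ∧ v ∉ affineSpan ℝ (vertexSet P \ {v})

/-- `P` is a pyramid over `Q`: `Q` is a facet of `P` and `P` is the convex hull of `Q`
together with one additional point (the apex) not in the affine span of `Q`. -/
def IsPyramidOver {N : ℕ} (P Q : Set (Fin N → ℝ)) : Prop :=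
  IsFacetOf P Q ∧ ∃ a : Fin N → ℝ, a ∉ affineSpan ℝ Q ∧ P = convexHull ℝ (Q ∪ {a})

/-- `P` is a `k`-fold pyramid over `Q`. -/
def IsKFoldPyramidOver {N : ℕ} : ℕ → Set (Fin N → ℝ) → Set (Fin N → ℝ) → Prop
  | 0, P, Q => P = Q
  | k + 1, P, Q => ∃ R : Set (Fin N → ℝ), IsKFoldPyramidOver k R Q ∧ IsPyramidOver P R

open Finset in
/-- The points of a polytope where a linear functional attains an upper bound `M` are spanned by
the generators where it does. -/
lemma mem_convexHull_filter_of_eq_bound {E : Type*} [AddCommGroup E] [Module ℝ E]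
    {S : Finset E} (l : E →ₗ[ℝ] ℝ) {M : ℝ} (hl : ∀ s ∈ S, l s ≤ M) {x : E}
    (hx : x ∈ convexHull ℝ (S : Set E)) (hxM : l x = M) :
    x ∈ convexHull ℝ {s | s ∈ S ∧ l s = M} := by
  obtain ⟨w, hw0, hw1, rfl⟩ := Finset.mem_convexHull'.1 hx
  have hsum : ∑ s ∈ S, w s * (M - l s) = 0 := by
    simp only [mul_sub, sum_sub_distrib, ← sum_mul, hw1]
    rw [← hxM, map_sum]
    simp
  have hzero := (sum_eq_zero_iff_of_nonneg fun s hs ↦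
    mul_nonneg (hw0 s hs) (sub_nonneg.2 (hl s hs))).1 hsum
  have hne : ∀ s ∈ S, w s ≠ 0 → l s = M := fun s hs h ↦ by
    have := (mul_eq_zero.1 (hzero s hs)).resolve_left h
    linarith
  classical
  rw [← sum_filter_of_ne (p := fun s ↦ l s = M) fun s hs h ↦ hne s hs fun h0 ↦ h (by simp [h0])]
  refine (convex_convexHull ℝ _).sum_mem (fun s hs ↦ hw0 s (mem_filter.1 hs).1) ?_ fun s hs ↦
    subset_convexHull ℝ _ (mem_filter.1 hs)
  rw [sum_filter_of_ne fun s hs h ↦ hne s hs h, hw1]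

lemma IsExposed.eq_convexHull_inter {N : ℕ} {S : Finset (Fin N → ℝ)} {F : Set (Fin N → ℝ)}
    (hF : IsExposed ℝ (convexHull ℝ (S : Set (Fin N → ℝ))) F) (hne : F.Nonempty) :
    F = convexHull ℝ (S ∩ F) := by
  obtain ⟨l, hl⟩ := hF hne
  obtain ⟨z, hz⟩ := hne
  have hz' := hz
  rw [hl] at hz'
  apply Set.Subset.antisymm
  · intro x hx
    have hx' := hx
    rw [hl] at hx'
    refine convexHull_mono ?_ (mem_convexHull_filter_of_eq_bound (l : (Fin N → ℝ) →ₗ[ℝ] ℝ)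
      (M := l x) (fun s hs ↦ hx'.2 s (subset_convexHull ℝ _ hs)) hx'.1 rfl)
    rintro s ⟨hs, hsx⟩
    refine ⟨hs, ?_⟩
    rw [hl]
    refine ⟨subset_convexHull ℝ _ hs, fun y hy ↦ ?_⟩
    have : l s = l x := hsx
    rw [this]
    exact hx'.2 y hy
  · refine convexHull_min inter_subset_right ?_
    have : F = {x ∈ convexHull ℝ (S : Set (Fin N → ℝ)) | l z ≤ l x} := by
      rw [hl]
      ext x
      exact ⟨fun h ↦ ⟨h.1, h.2 z hz'.1⟩, fun h ↦ ⟨h.1, fun y hy ↦ (hz'.2 y hy).trans h.2⟩⟩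
    rw [this]
    exact (convex_convexHull ℝ _).inter (convex_halfSpace_ge l.toLinearMap.isLinear _)

lemma finite_facetSet {N : ℕ} {P : Set (Fin N → ℝ)} (hP : IsPolytope P) : (facetSet P).Finite := by
  obtain ⟨S, rfl⟩ := hP
  refine ((S.finite_toSet.finite_subsets).image (convexHull ℝ)).subset ?_
  rintro F ⟨hF, hne, -⟩
  exact ⟨S ∩ F, inter_subset_left, (hF.eq_convexHull_inter hne).symm⟩

/-- A polytope is the convex hull of its vertices, which are in convex position. -/
lemma IsPolytope.exists_vertexSet_eq {N : ℕ} {P : Set (Fin N → ℝ)} (hP : IsPolytope P) :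
    ∃ S : Finset (Fin N → ℝ), vertexSet P = S ∧ P = convexHull ℝ (S : Set (Fin N → ℝ)) ∧
      ∀ s ∈ S, s ∉ convexHull ℝ ((S : Set (Fin N → ℝ)) \ {s}) := by
  classical
  obtain ⟨S₀, hS₀⟩ := hP
  obtain ⟨S, -, hS, hmin⟩ := exists_minimal_le_of_wellFoundedLT
    (fun S : Finset (Fin N → ℝ) ↦ P = convexHull ℝ (S : Set (Fin N → ℝ))) S₀ hS₀
  have hpos : ∀ s ∈ S, s ∉ convexHull ℝ ((S : Set (Fin N → ℝ)) \ {s}) := by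
    intro s hs hmem
    have hle := hmin (y := S.erase s) ?_ (Finset.erase_subset _ _)
    · exact Finset.notMem_erase s S (hle hs)
    · dsimp only
      rw [hS, Finset.coe_erase]
      refine Set.Subset.antisymm (convexHull_min ?_ (convex_convexHull ℝ _))
        (convexHull_mono sdiff_subset)
      intro t ht
      by_cases hts : t = s
      · rwa [hts]
      · exact subset_convexHull ℝ _ ⟨ht, hts⟩
  refine ⟨S, Set.Subset.antisymm ?_ ?_, hS, hpos⟩
  · intro v hv
    have hv' : IsExposed ℝ P {v} := hv
    rw [hS] at hv'
    have h := hv'.eq_convexHull_inter (singleton_nonempty v)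
    have hne : ((S : Set (Fin N → ℝ)) ∩ {v}).Nonempty := by
      rw [← convexHull_nonempty_iff (𝕜 := ℝ), ← h]
      exact singleton_nonempty v
    obtain ⟨w, hw, rfl⟩ := hne
    exact hw
  · intro s hs
    obtain ⟨l, u, hlu, hus⟩ := geometric_hahn_banach_closed_point (convex_convexHull ℝ _)
      ((S.finite_toSet.subset sdiff_subset).isClosed_convexHull ℝ) (hpos s hs)
    have hle : ∀ t ∈ S, l t ≤ l s := fun t ht ↦ by
      by_cases hts : t = s
      · rw [hts]
      · exact (hlu t (subset_convexHull ℝ _ ⟨ht, hts⟩)).le.trans hus.le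
    have hleP : ∀ y ∈ P, l y ≤ l s := by
      rw [hS]
      exact convexHull_min hle (convex_halfSpace_le l.toLinearMap.isLinear _)
    refine fun _ ↦ ⟨l, Set.Subset.antisymm ?_ ?_⟩
    · rintro _ rfl
      exact ⟨hS ▸ subset_convexHull ℝ _ hs, hleP⟩
    · rintro x ⟨hxP, hx⟩
      have hsP : s ∈ P := hS ▸ subset_convexHull ℝ _ hs
      have := mem_convexHull_filter_of_eq_bound (l : (Fin N → ℝ) →ₗ[ℝ] ℝ) (M := l s) hle
        (hS ▸ hxP) (le_antisymm (hleP x hxP) (hx s hsP))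
      refine (convexHull_min ?_ (convex_singleton s)) this
      rintro t ⟨ht, hts⟩
      by_contra hne
      have h1 := hlu t (subset_convexHull ℝ _ ⟨ht, hne⟩)
      have h2 : l t = l s := hts
      linarith

lemma pdim_convexHull {N : ℕ} (S : Set (Fin N → ℝ)) :
    pdim (convexHull ℝ S) = Module.finrank ℝ (vectorSpan ℝ S) := by
  rw [pdim, affineSpan_convexHull, direction_affineSpan]

/-- Affine functions on affinely independent points can be prescribed freely. -/
lemma AffineIndependent.exists_linearMap_sub_const {ι E : Type*} [AddCommGroup E] [Module ℝ E]
    {p : ι → E} (hp : AffineIndependent ℝ p) (f : ι → ℝ) :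
    ∃ (l : E →ₗ[ℝ] ℝ) (m : ℝ), ∀ i, l (p i) - m = f i := by
  rcases isEmpty_or_nonempty ι with _ | ⟨⟨i₀⟩⟩
  · exact ⟨0, 0, fun i ↦ isEmptyElim i⟩
  have hli := (affineIndependent_iff_linearIndependent_vsub ℝ p i₀).1 hp
  obtain ⟨l, hl⟩ := LinearMap.exists_extend
    ((Module.Basis.span hli).constr ℝ fun i ↦ f i - f i₀)
  refine ⟨l, l (p i₀) - f i₀, fun i ↦ ?_⟩
  by_cases hi : i = i₀
  · rw [hi]; ring
  have h1 : l (Module.Basis.span hli ⟨i, hi⟩) = f i - f i₀ := by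
    rw [← Module.Basis.constr_basis (Module.Basis.span hli) ℝ (fun i ↦ f i - f i₀) ⟨i, hi⟩, ← hl]
    rfl
  have h2 : ((Module.Basis.span hli ⟨i, hi⟩ : Submodule.span ℝ _) : E) = p i - p i₀ :=
    congrArg Subtype.val (Module.Basis.span_apply hli ⟨i, hi⟩)
  rw [h2, map_sub] at h1
  linarith

/-- In an affine dependence among `d + 2` points spanning dimension `d`, deleting a point with
nonzero coefficient leaves an affinely independent set. -/
lemma affineIndependent_erase_of_relation {E : Type*} [AddCommGroup E] [Module ℝ E]
    [DecidableEq E] {S : Finset E} {d : ℕ} (hcard : S.card = d + 2)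
    (hdim : Module.finrank ℝ (vectorSpan ℝ (S : Set E)) = d) {c : E → ℝ}
    (hc : ∑ s ∈ S, c s • s = 0) (hc0 : ∑ s ∈ S, c s = 0) {a : E} (ha : a ∈ S) (hca : c a ≠ 0) :
    AffineIndependent ℝ (fun s : ((S.erase a : Finset E) : Set E) ↦ (s : E)) := by
  have hcard' : (S.erase a).card = d + 1 := by rw [Finset.card_erase_of_mem ha]; omega
  obtain ⟨s₀, hs₀⟩ : (S.erase a).Nonempty := Finset.card_pos.1 (by omega)
  have hmem : a - s₀ ∈ vectorSpan ℝ (S.erase a : Set E) := by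
    have h0 : ∑ s ∈ S, c s • (s - s₀) = 0 := by
      simp only [smul_sub, Finset.sum_sub_distrib, ← Finset.sum_smul, hc, hc0, zero_smul, sub_zero]
    rw [← Finset.add_sum_erase _ _ ha] at h0
    rw [← Submodule.smul_mem_iff _ hca, eq_neg_of_add_eq_zero_left h0]
    exact neg_mem (Submodule.sum_mem _ fun s hs ↦
      Submodule.smul_mem _ _ (vsub_mem_vectorSpan ℝ (Finset.mem_coe.2 hs) (Finset.mem_coe.2 hs₀)))
  have hspan : a ∈ affineSpan ℝ (S.erase a : Set E) := by
    have := AffineSubspace.vadd_mem_of_mem_direction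
      (s := affineSpan ℝ (S.erase a : Set E)) (by rwa [direction_affineSpan])
      (subset_affineSpan ℝ _ (Finset.mem_coe.2 hs₀))
    simpa using this
  have hv : vectorSpan ℝ (S.erase a : Set E) = vectorSpan ℝ (S : Set E) := by
    have := vectorSpan_insert_eq_vectorSpan hspan
    rw [← this, ← Finset.coe_insert, Finset.insert_erase ha]
  have hfin : Fintype.card (S.erase a : Set E) = d + 1 := by
    rw [← hcard']
    exact Fintype.card_coe _
  rw [affineIndependent_iff_finrank_vectorSpan_eq ℝ _ hfin, Subtype.range_coe, hv, hdim]

/-- An affine function on the vertices that is nonpositive, compatible with the affine dependence,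
and nonzero at `x` but vanishing away from `a` and `x`, cuts out a facet. -/
lemma exists_facet_of_relation {N d : ℕ} {S : Finset (Fin N → ℝ)} (hcard : S.card = d + 2)
    (hdim : Module.finrank ℝ (vectorSpan ℝ (S : Set (Fin N → ℝ))) = d) {c : (Fin N → ℝ) → ℝ}
    (hc : ∑ s ∈ S, c s • s = 0) (hc0 : ∑ s ∈ S, c s = 0) {a x : Fin N → ℝ} (ha : a ∈ S)
    (hca : c a ≠ 0) (hx : x ∈ S) (hax : a ≠ x) (hd : d ≠ 0) {f : (Fin N → ℝ) → ℝ}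
    (hf : ∑ s ∈ S, c s * f s = 0)
    (hf0 : ∀ s ∈ S, f s ≤ 0) (hfx : f x ≠ 0) (hfs : ∀ s ∈ S, s ≠ a → s ≠ x → f s = 0) :
    ∃ F ∈ facetSet (convexHull ℝ (S : Set (Fin N → ℝ))), ∀ s ∈ S, s ∈ F ↔ f s = 0 := by
  classical
  have hai := affineIndependent_erase_of_relation hcard hdim hc hc0 ha hca
  obtain ⟨l, m, hlm⟩ := hai.exists_linearMap_sub_const fun s ↦ f s
  have hlf : ∀ s ∈ S, l s = m + f s := by
    have hne : ∀ s ∈ S.erase a, l s = m + f s := fun s hs ↦ by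
      have : l s - m = f s := hlm ⟨s, hs⟩
      linarith
    intro s hs
    by_cases hsa : s = a
    · subst hsa
      have h1 : ∑ t ∈ S, c t * (l t - m - f t) = 0 := by
        have h2 : ∑ t ∈ S, c t * l t = 0 := by
          have := congrArg l hc
          simpa using this
        simp only [mul_sub, Finset.sum_sub_distrib, ← Finset.sum_mul, h2, hc0, hf]
        simp
      rw [← Finset.add_sum_erase _ _ ha, Finset.sum_eq_zero (s := S.erase s) fun t ht ↦ by
        rw [hne t ht]; ring, add_zero] at h1
      have := (mul_eq_zero.1 h1).resolve_left hca
      linarith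
    · exact hne s (Finset.mem_erase.2 ⟨hsa, hs⟩)
  set F : Set (Fin N → ℝ) := {y ∈ convexHull ℝ (S : Set (Fin N → ℝ)) | l y = m} with hFdef
  have hle : ∀ y ∈ convexHull ℝ (S : Set (Fin N → ℝ)), l y ≤ m :=
    convexHull_min (fun s hs ↦ by
      have h1 := hlf s hs
      have h2 := hf0 s hs
      change l s ≤ m
      linarith) (convex_halfSpace_le l.isLinear _)
  have hmem : ∀ s ∈ S, s ∈ F ↔ f s = 0 := fun s hs ↦ by
    have h1 := hlf s hs
    refine ⟨fun h ↦ ?_, fun h ↦ ⟨subset_convexHull ℝ _ hs, ?_⟩⟩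
    · have := h.2
      linarith
    · rw [h1, h, add_zero]
  have hU : ((S.erase a).erase x).card = d := by
    rw [Finset.card_erase_of_mem (Finset.mem_erase.2 ⟨hax.symm, hx⟩),
      Finset.card_erase_of_mem ha]
    omega
  have hUF : ∀ s ∈ (S.erase a).erase x, s ∈ F := fun s hs ↦ by
    obtain ⟨hsx, hsa, hsS⟩ : s ≠ x ∧ s ≠ a ∧ s ∈ S := by simpa using hs
    exact (hmem s hsS).2 (hfs s hsS hsa hsx)
  obtain ⟨z, hz⟩ : ((S.erase a).erase x).Nonempty := Finset.card_pos.1 (by omega)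
  have hzF := hUF z hz
  refine ⟨F, ⟨fun _ ↦ ⟨LinearMap.toContinuousLinearMap l, ?_⟩, ⟨z, hzF⟩, ?_⟩, hmem⟩
  · ext y
    refine ⟨fun h ↦ ⟨h.1, fun y' hy' ↦ ?_⟩, fun h ↦ ⟨h.1, ?_⟩⟩
    · simpa [h.2] using hle y' hy'
    · refine le_antisymm (hle y h.1) ?_
      have := h.2 z hzF.1
      simpa [hzF.2] using this
  · rw [pdim_convexHull, hdim, pdim, direction_affineSpan]
    have hlow : d ≤ Module.finrank ℝ (vectorSpan ℝ F) + 1 := by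
      have hi : AffineIndependent ℝ ((↑) : ((S.erase a).erase x : Finset _) → Fin N → ℝ) :=
        hai.mono (s := ((S.erase a).erase x : Finset _)) (Finset.coe_subset.2 (Finset.erase_subset _ _))
      have h1 := hi.finrank_vectorSpan (n := d - 1) (by rw [Fintype.card_coe, hU]; omega)
      have h2 := Submodule.finrank_mono (vectorSpan_mono ℝ
        (show Set.range ((↑) : ((S.erase a).erase x : Finset _) → Fin N → ℝ) ⊆ F by
          rintro _ ⟨s, rfl⟩; exact hUF s s.2))
      omega
    have hup : Module.finrank ℝ (vectorSpan ℝ F) < d := by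
      rw [← hdim]
      refine Submodule.finrank_lt_finrank_of_lt (lt_of_le_of_ne ?_ ?_)
      · rw [← direction_affineSpan, ← direction_affineSpan,
          ← affineSpan_convexHull (𝕜 := ℝ) (S : Set (Fin N → ℝ))]
        exact AffineSubspace.direction_le (affineSpan_mono ℝ fun y hy ↦ hy.1)
      · intro heq
        have hzS : z ∈ S := Finset.mem_of_mem_erase (Finset.mem_of_mem_erase hz)
        have hxz : x - z ∈ vectorSpan ℝ F := by
          rw [heq]
          exact vsub_mem_vectorSpan ℝ (Finset.mem_coe.2 hx) (Finset.mem_coe.2 hzS)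
        have hker : vectorSpan ℝ F ≤ LinearMap.ker l := by
          rw [vectorSpan, Submodule.span_le]
          rintro _ ⟨y, hy, y', hy', rfl⟩
          simp [hy.2, hy'.2]
        have := hker hxz
        rw [LinearMap.mem_ker, map_sub, hlf x hx, hzF.2] at this
        exact hfx (by linarith)
    omega

/-- In a 2-neighborly polytope, every affine dependence among the vertices has at least three
positive coefficients. -/
lemma TwoNeighborly.three_le_card_pos {N : ℕ} {S : Finset (Fin N → ℝ)}
    (hV : vertexSet (convexHull ℝ (S : Set (Fin N → ℝ))) = S)
    (hpos : ∀ s ∈ S, s ∉ convexHull ℝ ((S : Set (Fin N → ℝ)) \ {s}))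
    (hnb : TwoNeighborly (convexHull ℝ (S : Set (Fin N → ℝ)))) (hS : 2 ≤ S.card)
    {c : (Fin N → ℝ) → ℝ} (hc : ∑ s ∈ S, c s • s = 0) (hc0 : ∑ s ∈ S, c s = 0)
    (hne : ∃ s ∈ S, c s ≠ 0) : 3 ≤ (S.filter fun s ↦ 0 < c s).card := by
  classical
  by_contra! hlt
  obtain ⟨U, hAU, hUS, hU⟩ := Finset.exists_subsuperset_card_eq (n := 2)
    (Finset.filter_subset (fun s ↦ 0 < c s) S) (by omega) hS
  obtain ⟨u, v, huv, rfl⟩ := Finset.card_eq_two.1 hU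
  have huS : u ∈ S := hUS (by simp)
  have hvS : v ∈ S := hUS (by simp)
  have hver : ∀ s ∈ S, IsVertex (convexHull ℝ (S : Set (Fin N → ℝ))) s := fun s hs ↦ by
    have : s ∈ vertexSet (convexHull ℝ (S : Set (Fin N → ℝ))) := by rwa [hV]
    exact this
  obtain ⟨l, hl⟩ := (hnb u v (hver u huS) (hver v hvS) huv).1 ⟨u, subset_convexHull ℝ _ (by simp)⟩
  have hmax : ∀ t ∈ ({u, v} : Set (Fin N → ℝ)), ∀ s ∈ S, l s ≤ l t := fun t ht s hs ↦ by
    have : t ∈ convexHull ℝ {u, v} := subset_convexHull ℝ _ ht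
    rw [hl] at this
    exact this.2 s (subset_convexHull ℝ _ hs)
  have huv_eq : l u = l v := le_antisymm (hmax v (by simp) u huS) (hmax u (by simp) v hvS)
  have hsum : ∑ s ∈ S, c s * (l s - l u) = 0 := by
    have h2 : ∑ t ∈ S, c t * l t = 0 := by
      have := congrArg l hc
      simpa using this
    simp only [mul_sub, Finset.sum_sub_distrib, ← Finset.sum_mul, h2, hc0]
    simp
  have hterm : ∀ s ∈ S, 0 ≤ c s * (l s - l u) := fun s hs ↦ by
    by_cases hs0 : 0 < c s
    · have : s ∈ ({u, v} : Finset (Fin N → ℝ)) := hAU (Finset.mem_filter.2 ⟨hs, hs0⟩)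
      rcases (by simpa using this : s = u ∨ s = v) with rfl | rfl
      · simp
      · simp [huv_eq]
    · exact mul_nonneg_of_nonpos_of_nonpos (not_lt.1 hs0) (sub_nonpos.2 (hmax u (by simp) s hs))
  have hzero := (Finset.sum_eq_zero_iff_of_nonneg hterm).1 hsum
  have hsupp : ∀ s ∈ S, s ≠ u → s ≠ v → c s = 0 := fun s hs hsu hsv ↦ by
    by_contra hcs
    have hlsu : l s = l u := by
      have := (mul_eq_zero.1 (hzero s hs)).resolve_left hcs
      linarith
    have : s ∈ convexHull ℝ {u, v} := by
      rw [hl]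
      refine ⟨subset_convexHull ℝ _ hs, ?_⟩
      rw [hlsu]
      have : u ∈ convexHull ℝ {u, v} := subset_convexHull ℝ _ (by simp)
      rw [hl] at this
      exact this.2
    refine hpos s hs (convexHull_mono ?_ this)
    rintro t (rfl | rfl)
    · exact ⟨huS, hsu.symm⟩
    · exact ⟨hvS, hsv.symm⟩
  have hred : ∀ {M : Type} [AddCommMonoid M] (g : (Fin N → ℝ) → M), (∀ s, c s = 0 → g s = 0) →
      ∑ s ∈ S, g s = g u + g v := fun g hg ↦ by
    rw [← Finset.sum_pair huv]
    refine (Finset.sum_subset hUS fun s hs hs' ↦ hg s (hsupp s hs ?_ ?_)).symm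
    · rintro rfl; simp at hs'
    · rintro rfl; simp at hs'
  rw [hred _ fun s hs ↦ hs] at hc0
  rw [hred _ fun s hs ↦ by simp [hs]] at hc
  have hcv : c v = -c u := by linarith
  rw [hcv, neg_smul, ← sub_eq_add_neg, ← smul_sub, smul_eq_zero] at hc
  have hcu := hc.resolve_right (sub_ne_zero.2 huv)
  obtain ⟨s, hs, hcs⟩ := hne
  apply hcs
  by_cases hsu : s = u
  · rw [hsu, hcu]
  by_cases hsv : s = v
  · rw [hsv, hcv, hcu, neg_zero]
  exact hsupp s hs hsu hsv

/-- For every integer `d ≥ 4`, every 2-neighborly `d`-polytope with exactly `d + 2`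
vertices has at least `d + 5` facets. -/
theorem two_neighborly_d_plus_two_vertices
    (d : ℕ) (hd : 4 ≤ d) {N : ℕ} (P : Set (Fin N → ℝ))
    (hP : IsPolytope P) (hdim : pdim P = d) (hnb : TwoNeighborly P)
    (hv : (vertexSet P).ncard = d + 2) :
    d + 5 ≤ (facetSet P).ncard := by
  classical
  have hfin := finite_facetSet hP
  obtain ⟨S, hV, rfl, hpos⟩ := hP.exists_vertexSet_eq
  have hcard : S.card = d + 2 := by rwa [hV, ncard_coe_finset] at hv
  rw [pdim_convexHull] at hdim
  obtain ⟨c, hc, hc0, hne⟩ : ∃ c : (Fin N → ℝ) → ℝ, ∑ s ∈ S, c s • s = 0 ∧ ∑ s ∈ S, c s = 0 ∧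
      ∃ s ∈ S, c s ≠ 0 := by
    refine exists_nontrivial_relation_sum_zero_of_not_affine_ind fun hai ↦ ?_
    have := hai.finrank_vectorSpan (n := d + 1) (by simpa using hcard)
    have hr : Set.range ((↑) : {x // x ∈ S} → Fin N → ℝ) = S := Subtype.range_coe
    rw [hr, hdim] at this
    omega
  set A := S.filter fun s ↦ 0 < c s with hA
  set B := S.filter fun s ↦ c s < 0 with hB
  set C := S.filter fun s ↦ c s = 0 with hC
  have hA3 : 3 ≤ A.card := hnb.three_le_card_pos hV hpos (by omega) hc hc0 hne
  have hB3 : 3 ≤ B.card := by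
    have := hnb.three_le_card_pos hV hpos (by omega) (c := fun s ↦ -c s) (by simpa using hc)
      (by simpa using hc0) (by simpa using hne)
    simpa using this
  have hABC : A.card + B.card + C.card = d + 2 := by
    rw [← hcard, ← Finset.card_union_of_disjoint, ← Finset.card_union_of_disjoint]
    · congr 1
      ext s
      simp only [hA, hB, hC, Finset.mem_union, Finset.mem_filter]
      have := lt_trichotomy (c s) 0
      tauto
    · rw [Finset.disjoint_left]
      simp only [hA, hB, hC, Finset.mem_union, Finset.mem_filter]
      rintro s (⟨-, h⟩ | ⟨-, h⟩) ⟨-, h'⟩ <;> linarith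
    · rw [Finset.disjoint_left]
      simp only [hA, hB, Finset.mem_filter]
      rintro s ⟨-, h⟩ ⟨-, h'⟩
      linarith
  obtain ⟨a₀, ha₀⟩ : A.Nonempty := Finset.card_pos.1 (by omega)
  have hapex : ∀ x ∈ C, ∃ F ∈ facetSet (convexHull ℝ (S : Set (Fin N → ℝ))),
      ∀ s ∈ S, s ∉ F ↔ s = x := by
    intro x hx
    obtain ⟨hxS, hcx⟩ := Finset.mem_filter.1 hx
    obtain ⟨haS, hca⟩ := Finset.mem_filter.1 ha₀
    obtain ⟨F, hF, hmem⟩ := exists_facet_of_relation hcard hdim hc hc0 haS hca.ne' hxS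
      (by rintro rfl; exact hca.ne' hcx) (by omega) (f := fun s ↦ if s = x then -1 else 0)
      (by simp [hcx]) (fun s _ ↦ by split_ifs <;> norm_num) (by simp)
      (fun s _ _ h ↦ by simp [h])
    exact ⟨F, hF, fun s hs ↦ by rw [hmem s hs]; simp⟩
  have hpair : ∀ q ∈ A ×ˢ B, ∃ F ∈ facetSet (convexHull ℝ (S : Set (Fin N → ℝ))),
      ∀ s ∈ S, s ∉ F ↔ s = q.1 ∨ s = q.2 := by
    rintro ⟨a, b⟩ hab
    obtain ⟨ha, hb⟩ := Finset.mem_product.1 hab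
    obtain ⟨haS, hca⟩ := Finset.mem_filter.1 ha
    obtain ⟨hbS, hcb⟩ := Finset.mem_filter.1 hb
    dsimp only at haS hca hbS hcb
    have hne : a ≠ b := by rintro rfl; linarith
    obtain ⟨F, hF, hmem⟩ := exists_facet_of_relation hcard hdim hc hc0 haS hca.ne' hbS hne
      (by omega) (f := fun s ↦ (if s = a then c b else 0) + if s = b then -c a else 0)
      (by simp [mul_add, Finset.sum_add_distrib, haS, hbS]; ring)
      (fun s _ ↦ by split_ifs <;> linarith) (by simp [hne.symm, hca.ne'])
      (fun s _ h h' ↦ by simp [h, h'])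
    refine ⟨F, hF, fun s hs ↦ ?_⟩
    rw [hmem s hs]
    by_cases h1 : s = a
    · subst h1
      simp [hne, hcb.ne]
    · by_cases h2 : s = b
      · subst h2
        simp [h1, hca.ne']
      · simp [h1, h2]
  choose! G hG hGmem using hapex
  choose! H hH hHmem using hpair
  have hCS : ∀ x ∈ C, x ∈ S ∧ c x = 0 := fun x hx ↦ Finset.mem_filter.1 hx
  have hABS : ∀ q ∈ A ×ˢ B, (q.1 ∈ S ∧ 0 < c q.1) ∧ q.2 ∈ S ∧ c q.2 < 0 := fun q hq ↦ by
    simpa [hA, hB] using hq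
  have hGinj : Set.InjOn G C := fun x hx y hy hxy ↦ by
    have hxS := (hCS x hx).1
    rw [← hGmem y hy x hxS, ← hxy, hGmem x hx x hxS]
  have hHinj : Set.InjOn H ↑(A ×ˢ B) := fun q hq r hr hqr ↦ by
    obtain ⟨⟨h1, h2⟩, h3, h4⟩ := hABS q hq
    obtain ⟨⟨h5, h6⟩, h7, h8⟩ := hABS r hr
    have e1 : q.1 = r.1 ∨ q.1 = r.2 := by
      rw [← hHmem r hr _ h1, ← hqr, hHmem q hq _ h1]; exact Or.inl rfl
    have e2 : q.2 = r.1 ∨ q.2 = r.2 := by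
      rw [← hHmem r hr _ h3, ← hqr, hHmem q hq _ h3]; exact Or.inr rfl
    refine Prod.ext (e1.resolve_right fun h ↦ ?_) (e2.resolve_left fun h ↦ ?_)
    · rw [h] at h2; linarith
    · rw [h] at h4; linarith
  have hdisj : Disjoint (C.image G) ((A ×ˢ B).image H) := by
    rw [Finset.disjoint_left]
    rintro F hF hF'
    obtain ⟨x, hx, rfl⟩ := Finset.mem_image.1 hF
    obtain ⟨q, hq, hqx⟩ := Finset.mem_image.1 hF'
    obtain ⟨⟨h1, h2⟩, -, -⟩ := hABS q hq
    have : q.1 = x := by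
      rw [← hGmem x hx _ h1, ← hqx, hHmem q hq _ h1]; exact Or.inl rfl
    rw [this, (hCS x hx).2] at h2
    exact lt_irrefl _ h2
  have hsub : ((C.image G ∪ (A ×ˢ B).image H : Finset _) : Set (Set (Fin N → ℝ))) ⊆
      facetSet (convexHull ℝ (S : Set (Fin N → ℝ))) := by
    intro F hF
    rcases Finset.mem_union.1 (Finset.mem_coe.1 hF) with hF | hF
    · obtain ⟨x, hx, rfl⟩ := Finset.mem_image.1 hF
      exact hG x hx
    · obtain ⟨q, hq, rfl⟩ := Finset.mem_image.1 hF
      exact hH q hq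
  have hle := ncard_le_ncard hsub hfin
  rw [ncard_coe_finset, Finset.card_union_of_disjoint hdisj, Finset.card_image_of_injOn hGinj,
    Finset.card_image_of_injOn hHinj, Finset.card_product] at hle
  nlinarith
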